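/- arXiv:1607.05100 — 2 statements merged into one kernel-verified Lean document; each statement's English description precedes it below -/
import Mathlib

section
/- (The RQFT on L² preserves the quaternionic inner product.) Let Ψ_r : L²(ℝ²,ℍ) → L²(ℝ²,ℍ) be continuous with respect to the L² norm and agree almost everywhere with ℱ_r on L¹(ℝ²,ℍ) ∩ L²(ℝ²,ℍ). Then for all f, g ∈ L²(ℝ²,ℍ), ∫_{ℝ²} f(x₁,x₂) conj(g(x₁,x₂)) dx₁ dx₂ = ∫_{ℝ²} (Ψ_r f)(ω₁,ω₂) conj((Ψ_r g)(ω₁,ω₂)) dω₁ dω₂. -/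
open MeasureTheory Real ENNReal

noncomputable section

/-- The real quaternions. -/
abbrev Hq := Quaternion ℝ

/-- The imaginary unit `i`. -/
def qi : Hq := ⟨0,1,0,0⟩
/-- The imaginary unit `j`. -/
def qj : Hq := ⟨0,0,1,0⟩
/-- The imaginary unit `k`. -/
def qk : Hq := ⟨0,0,0,1⟩

/-- For a (unit pure imaginary) quaternion `u`, `e^{uθ} := cos θ + u sin θ`. -/
def qexp (u : Hq) (θ : ℝ) : Hq := (Real.cos θ) • (1 : Hq) + (Real.sin θ) • u

/-- The right-sided quaternion Fourier transform of `f ∈ L¹(ℝ²,ℍ)`. -/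
def Fr (f : ℝ × ℝ → Hq) (ω : ℝ × ℝ) : Hq :=
  (1 / (2 * Real.pi)) • ∫ x : ℝ × ℝ, f x * qexp qi (-(ω.1 * x.1)) * qexp qj (-(ω.2 * x.2))

/-- The two-sided quaternion Fourier transform of `f ∈ L¹(ℝ²,ℍ)`. -/
def Fs (f : ℝ × ℝ → Hq) (ω : ℝ × ℝ) : Hq :=
  (1 / (2 * Real.pi)) • ∫ x : ℝ × ℝ, qexp qi (-(ω.1 * x.1)) * f x * qexp qj (-(ω.2 * x.2))


section oneDim
open FourierTransform

lemma fourier_toLp_ae {u : ℝ → ℂ} (h1 : Integrable u) (h2 : MemLp u 2) :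
    ((𝓕 (h2.toLp u) : Lp ℂ 2 (volume : Measure ℝ)) : ℝ → ℂ) =ᵐ[volume] 𝓕 u := by
  have hc : Continuous (𝓕 u) := by
    exact VectorFourier.fourierIntegral_continuous Real.continuous_fourierChar
      (by exact continuous_inner) h1
  refine ae_eq_of_integral_contDiff_smul_eq ((Lp.memLp _).locallyIntegrable (by norm_num))
    hc.locallyIntegrable ?_
  intro g hg1 hg2
  have hg₁ : HasCompactSupport (Complex.ofRealCLM ∘ g) := hg2.comp_left rfl
  have hg₂ : ContDiff ℝ ((⊤ : ℕ∞) : WithTop ℕ∞) (Complex.ofRealCLM ∘ g) := by fun_prop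
  set G := hg₁.toSchwartzMap hg₂ with hG
  have key := congrArg (fun T => T G)
    (Lp.fourier_toTemperedDistribution_eq (h2.toLp u))
  simp only [TemperedDistribution.fourier_apply, Lp.toTemperedDistribution_apply] at key
  have hGx : ∀ x, G x = (g x : ℂ) := fun x => rfl
  have e1 : ∫ x, g x • (𝓕 (h2.toLp u) : Lp ℂ 2 (volume : Measure ℝ)) x
      = ∫ x, G x • (𝓕 (h2.toLp u) : Lp ℂ 2 (volume : Measure ℝ)) x := by
    simp [hGx]
  rw [e1, ← key]
  have e2 : ∫ x, (𝓕 G) x • (h2.toLp u) x = ∫ x, (𝓕 G) x • u x := by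
    apply integral_congr_ae
    filter_upwards [h2.coeFn_toLp] with x hx
    rw [hx]
  rw [e2]
  have := VectorFourier.integral_fourierIntegral_smul_eq_flip (L := innerₗ ℝ) (μ := volume)
    (ν := volume) Real.continuous_fourierChar continuous_inner G.integrable h1
  have e3 : ∀ x, g x • 𝓕 u x = G x • 𝓕 u x := by intro x; simp [hGx]
  simp_rw [e3]
  simpa using! this

/-- Fourier transform with the kernel `e^{-iωx}`. -/
def hat (u : ℝ → ℂ) (ω : ℝ) : ℂ := ∫ x, u x * Complex.exp (((-(ω * x) : ℝ) : ℂ) * Complex.I)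

lemma hat_eq (u : ℝ → ℂ) (ω : ℝ) : hat u ω = 𝓕 u ((2 * π)⁻¹ * ω) := by
  rw [Real.fourier_real_eq_integral_exp_smul, hat]
  congr 1; ext x
  rw [smul_eq_mul, mul_comm]
  congr 4
  field_simp

lemma fourier_memLp {u : ℝ → ℂ} (h1 : Integrable u) (h2 : MemLp u 2) : MemLp (𝓕 u) 2 :=
  (memLp_congr_ae (fourier_toLp_ae h1 h2)).1 (Lp.memLp _)

lemma integrable_fourier {u v : ℝ → ℂ} (h1 : Integrable u) (h2 : MemLp u 2)
    (k1 : Integrable v) (k2 : MemLp v 2) :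
    Integrable (fun ω => 𝓕 u ω * star (𝓕 v ω)) :=
  (fourier_memLp h1 h2).integrable_mul (fourier_memLp k1 k2).star

lemma integral_fourier {u v : ℝ → ℂ} (h1 : Integrable u) (h2 : MemLp u 2)
    (k1 : Integrable v) (k2 : MemLp v 2) :
    ∫ ω, 𝓕 u ω * star (𝓕 v ω) = ∫ x, u x * star (v x) := by
  have := Lp.inner_fourier_eq (k2.toLp v) (h2.toLp u)
  rw [L2.inner_def, L2.inner_def] at this
  calc _ = _ := ?_
    _ = _ := this
    _ = _ := ?_
  · apply integral_congr_ae
    filter_upwards [fourier_toLp_ae h1 h2, fourier_toLp_ae k1 k2] with x a b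
    rw [a, b]; simp
  · apply integral_congr_ae
    filter_upwards [h2.coeFn_toLp, k2.coeFn_toLp] with x a b
    rw [a, b]; simp

lemma integrable_hat {u v : ℝ → ℂ} (h1 : Integrable u) (h2 : MemLp u 2)
    (k1 : Integrable v) (k2 : MemLp v 2) :
    Integrable (fun ω => hat u ω * star (hat v ω)) := by
  simp_rw [hat_eq]
  exact (integrable_fourier h1 h2 k1 k2).comp_mul_left' (by positivity)

lemma integral_hat {u v : ℝ → ℂ} (h1 : Integrable u) (h2 : MemLp u 2)
    (k1 : Integrable v) (k2 : MemLp v 2) :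
    ∫ ω, hat u ω * star (hat v ω) = (2 * π : ℝ) • ∫ x, u x * star (v x) := by
  simp_rw [hat_eq]
  rw [Measure.integral_comp_mul_left (fun ω => 𝓕 u ω * star (𝓕 v ω)),
    integral_fourier h1 h2 k1 k2, inv_inv, abs_of_pos (by positivity)]

end oneDim

/-- Constant quaternion multiples of indicators of rectangles of finite measure. -/
def rectSet : Set (Lp Hq 2 (volume : Measure (ℝ × ℝ))) :=
  {p | ∃ (A B : Set ℝ) (hA : MeasurableSet A) (hB : MeasurableSet B)
    (_ : volume A ≠ ∞) (_ : volume B ≠ ∞) (hAB : volume (A ×ˢ B) ≠ ∞) (c : Hq),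
    p = indicatorConstLp 2 (hA.prod hB) hAB c}

lemma rect_ne_top {A B : Set ℝ} (h1 : volume A ≠ ∞) (h2 : volume B ≠ ∞) :
    volume (A ×ˢ B) ≠ ∞ := by
  rw [Measure.volume_eq_prod, Measure.prod_prod]
  exact ENNReal.mul_ne_top h1 h2

lemma ae_zero_of_rect (h : Lp Hq 2 (volume : Measure (ℝ × ℝ)))
    (hz : ∀ A B : Set ℝ, MeasurableSet A → MeasurableSet B → volume A ≠ ∞ → volume B ≠ ∞ →
      ∫ x in A ×ˢ B, h x = 0) : (h : ℝ × ℝ → Hq) =ᵐ[volume] 0 := by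
  have hint : ∀ s : Set (ℝ × ℝ), volume s < ∞ → IntegrableOn h s := by
    intro s hs
    have : IsFiniteMeasure (volume.restrict s) := ⟨by simpa using hs⟩
    exact ((Lp.memLp h).restrict s).integrable (by norm_num)
  let I : ℕ → Set ℝ := fun n => Set.Icc (-(n : ℝ)) n
  have hI : ∀ n, MeasurableSet (I n) := fun n => measurableSet_Icc
  have hIf : ∀ n, volume (I n) ≠ ∞ := fun n => by simp [I]
  have hII : ∀ n, volume (I n ×ˢ I n) ≠ ∞ := fun n => rect_ne_top (hIf n) (hIf n)
  have main : ∀ n, ∀ᵐ x ∂(volume.restrict (I n ×ˢ I n)), h x = 0 := by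
    intro n
    have hi : Integrable h (volume.restrict (I n ×ˢ I n)) := hint _ (hII n).lt_top
    have hall : ∀ s, MeasurableSet s → ∫ x in s, h x ∂(volume.restrict (I n ×ˢ I n)) = 0 := by
      intro s hs
      induction s, hs using MeasurableSpace.induction_on_inter
        generateFrom_prod.symm isPiSystem_prod with
      | empty => simp
      | basic t ht =>
        obtain ⟨A, hA, B, hB, rfl⟩ := ht
        replace hA : MeasurableSet A := hA
        replace hB : MeasurableSet B := hB
        rw [Measure.restrict_restrict (hA.prod hB), Set.prod_inter_prod]
        exact hz _ _ (hA.inter (hI n)) (hB.inter (hI n))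
          (measure_ne_top_of_subset Set.inter_subset_right (hIf n))
          (measure_ne_top_of_subset Set.inter_subset_right (hIf n))
      | compl t ht ih =>
        rw [setIntegral_compl ht hi, ih, hz _ _ (hI n) (hI n) (hIf n) (hIf n), sub_zero]
      | iUnion f hd hm ih =>
        rw [integral_iUnion hm hd hi.integrableOn]
        simp [ih]
    exact hi.ae_eq_zero_of_forall_setIntegral_eq_zero (fun s hs _ => hall s hs)
  have hU : (⋃ n, I n ×ˢ I n) = Set.univ := by
    ext ⟨a, b⟩
    obtain ⟨n, hn⟩ := exists_nat_ge (max |a| |b|)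
    simp only [Set.mem_iUnion, Set.mem_univ, iff_true]
    refine ⟨n, ?_, ?_⟩
    · exact abs_le.1 ((le_max_left _ _).trans hn)
    · exact abs_le.1 ((le_max_right _ _).trans hn)
  have := (ae_restrict_iUnion_iff (fun n => I n ×ˢ I n) (fun x => h x = 0)).2 main
  rw [hU, Measure.restrict_univ] at this
  exact this

lemma dense_rect : Dense (Submodule.span ℝ rectSet : Set (Lp Hq 2 (volume : Measure (ℝ × ℝ)))) := by
  rw [Submodule.dense_iff_topologicalClosure_eq_top, Submodule.topologicalClosure_eq_top_iff,
    Submodule.eq_bot_iff]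
  intro h hh
  rw [Submodule.mem_orthogonal] at hh
  rw [Lp.eq_zero_iff_ae_eq_zero]
  apply ae_zero_of_rect
  intro A B hA hB h1 h2
  have := hh (indicatorConstLp 2 (hA.prod hB) (rect_ne_top h1 h2) (∫ x in A ×ˢ B, h x))
    (Submodule.subset_span ⟨A, B, hA, hB, h1, h2, rect_ne_top h1 h2, _, rfl⟩)
  rw [L2.inner_indicatorConstLp_eq_inner_setIntegral] at this
  exact inner_self_eq_zero.1 this
set_option linter.unusedSimpArgs false

/-- The real-linear embedding of `ℂ` into the quaternions with `I ↦ u`. -/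
def emb (u : Hq) : ℂ →L[ℝ] Hq :=
  Complex.reCLM.smulRight (1 : Hq) + Complex.imCLM.smulRight u

lemma emb_apply (u : Hq) (z : ℂ) : emb u z = z.re • (1 : Hq) + z.im • u := rfl

lemma qexp_eq (u : Hq) (θ : ℝ) : qexp u θ = emb u (Complex.exp ((θ : ℂ) * Complex.I)) := by
  rw [emb_apply, Complex.exp_ofReal_mul_I_re, Complex.exp_ofReal_mul_I_im, qexp]

lemma emb_qi_re (z : ℂ) : (emb qi z).re = z.re := by
  change z.re * 1 + z.im * 0 = z.re
  ring

lemma emb_qi_imI (z : ℂ) : (emb qi z).imI = z.im := by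
  change z.re * 0 + z.im * 1 = z.im
  ring

lemma emb_qi_imJ (z : ℂ) : (emb qi z).imJ = 0 := by
  change z.re * 0 + z.im * 0 = 0
  ring

lemma emb_qi_imK (z : ℂ) : (emb qi z).imK = 0 := by
  change z.re * 0 + z.im * 0 = 0
  ring

lemma emb_mul_qi (z w : ℂ) : emb qi z * emb qi w = emb qi (z * w) := by
  apply Quaternion.ext
  · rw [Quaternion.re_mul]; simp [emb_qi_re, emb_qi_imI, emb_qi_imJ, emb_qi_imK]
  · rw [Quaternion.imI_mul]; simp [emb_qi_re, emb_qi_imI, emb_qi_imJ, emb_qi_imK]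
  · rw [Quaternion.imJ_mul]; simp [emb_qi_re, emb_qi_imI, emb_qi_imJ, emb_qi_imK]
  · rw [Quaternion.imK_mul]; simp [emb_qi_re, emb_qi_imI, emb_qi_imJ, emb_qi_imK]

lemma emb_star_qi (z : ℂ) : star (emb qi z) = emb qi (star z) := by
  apply Quaternion.ext
  · rw [Quaternion.re_star]; simp [emb_qi_re, emb_qi_imI, emb_qi_imJ, emb_qi_imK]
  · rw [Quaternion.imI_star]; simp [emb_qi_re, emb_qi_imI, emb_qi_imJ, emb_qi_imK]
  · rw [Quaternion.imJ_star]; simp [emb_qi_re, emb_qi_imI, emb_qi_imJ, emb_qi_imK]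
  · rw [Quaternion.imK_star]; simp [emb_qi_re, emb_qi_imI, emb_qi_imJ, emb_qi_imK]

lemma emb_qj_re (z : ℂ) : (emb qj z).re = z.re := by
  change z.re * 1 + z.im * 0 = z.re
  ring

lemma emb_qj_imI (z : ℂ) : (emb qj z).imI = 0 := by
  change z.re * 0 + z.im * 0 = 0
  ring

lemma emb_qj_imJ (z : ℂ) : (emb qj z).imJ = z.im := by
  change z.re * 0 + z.im * 1 = z.im
  ring

lemma emb_qj_imK (z : ℂ) : (emb qj z).imK = 0 := by
  change z.re * 0 + z.im * 0 = 0
  ring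

lemma emb_mul_qj (z w : ℂ) : emb qj z * emb qj w = emb qj (z * w) := by
  apply Quaternion.ext
  · rw [Quaternion.re_mul]; simp [emb_qj_re, emb_qj_imI, emb_qj_imJ, emb_qj_imK]
  · rw [Quaternion.imI_mul]; simp [emb_qj_re, emb_qj_imI, emb_qj_imJ, emb_qj_imK]
  · rw [Quaternion.imJ_mul]; simp [emb_qj_re, emb_qj_imI, emb_qj_imJ, emb_qj_imK]
  · rw [Quaternion.imK_mul]; simp [emb_qj_re, emb_qj_imI, emb_qj_imJ, emb_qj_imK]

lemma emb_star_qj (z : ℂ) : star (emb qj z) = emb qj (star z) := by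
  apply Quaternion.ext
  · rw [Quaternion.re_star]; simp [emb_qj_re, emb_qj_imI, emb_qj_imJ, emb_qj_imK]
  · rw [Quaternion.imI_star]; simp [emb_qj_re, emb_qj_imI, emb_qj_imJ, emb_qj_imK]
  · rw [Quaternion.imJ_star]; simp [emb_qj_re, emb_qj_imI, emb_qj_imJ, emb_qj_imK]
  · rw [Quaternion.imK_star]; simp [emb_qj_re, emb_qj_imI, emb_qj_imJ, emb_qj_imK]

lemma emb_real (u : Hq) (r : ℝ) : emb u (r : ℂ) = r • (1 : Hq) := by
  rw [emb_apply]; simp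

/-- Indicator function with complex values. -/
def ind (A : Set ℝ) : ℝ → ℂ := A.indicator (fun _ => 1)

lemma ind_integrable {A : Set ℝ} (hA : MeasurableSet A) (h : volume A ≠ ∞) :
    Integrable (ind A) := by
  exact (integrable_indicator_iff hA).2 (integrableOn_const h)

lemma ind_memLp {A : Set ℝ} (hA : MeasurableSet A) (h : volume A ≠ ∞) :
    MemLp (ind A) 2 := memLp_indicator_const 2 hA 1 (Or.inr h)

lemma ind_integral {A B : Set ℝ} (hA : MeasurableSet A) (hB : MeasurableSet B) :
    ∫ x, ind A x * star (ind B x) = ((volume.real (A ∩ B) : ℝ) : ℂ) := by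
  have : (fun x => ind A x * star (ind B x)) = (A ∩ B).indicator (fun _ => (1 : ℂ)) := by
    ext x
    by_cases h1 : x ∈ A <;> by_cases h2 : x ∈ B <;> simp [ind, h1, h2]
  rw [this, integral_indicator (hA.inter hB)]
  simp

lemma Fr_rect {A B : Set ℝ} (hA : MeasurableSet A) (hB : MeasurableSet B)
    (h1 : volume A ≠ ∞) (h2 : volume B ≠ ∞) (hAB : volume (A ×ˢ B) ≠ ∞) (c : Hq) (ω : ℝ × ℝ) :
    Fr (indicatorConstLp 2 (hA.prod hB) hAB c : Lp Hq 2 (volume : Measure (ℝ × ℝ))) ω =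
      (1 / (2 * Real.pi)) • (c * emb qi (hat (ind A) ω.1) * emb qj (hat (ind B) ω.2)) := by
  unfold Fr
  congr 1
  let a : ℝ → ℂ := fun x => ind A x * Complex.exp (((-(ω.1 * x) : ℝ) : ℂ) * Complex.I)
  let b : ℝ → ℂ := fun x => ind B x * Complex.exp (((-(ω.2 * x) : ℝ) : ℂ) * Complex.I)
  have aux : ∀ (t : ℝ) {S : Set ℝ}, MeasurableSet S → volume S ≠ ∞ →
      Integrable (fun x => ind S x * Complex.exp (((-(t * x) : ℝ) : ℂ) * Complex.I)) := by
    intro t S hS hS'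
    refine (ind_integrable hS hS').mul_bdd (c := 1) ?_ ?_
    · exact (by fun_prop : Continuous _).aestronglyMeasurable
    · exact Filter.Eventually.of_forall fun x => (Complex.norm_exp_ofReal_mul_I _).le
  have ha : Integrable a := aux _ hA h1
  have hb : Integrable b := aux _ hB h2
  have e1 : (∫ x : ℝ × ℝ, (indicatorConstLp 2 (hA.prod hB) hAB c :
        Lp Hq 2 (volume : Measure (ℝ × ℝ))) x *
        qexp qi (-(ω.1 * x.1)) * qexp qj (-(ω.2 * x.2)))
      = ∫ x : ℝ × ℝ, (c * emb qi (a x.1)) * emb qj (b x.2) := by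
    apply integral_congr_ae
    filter_upwards [indicatorConstLp_coeFn (p := 2) (hs := hA.prod hB) (hμs := hAB) (c := c)]
      with x hx
    rw [hx, qexp_eq, qexp_eq]
    by_cases k1 : x.1 ∈ A <;> by_cases k2 : x.2 ∈ B <;>
      simp [a, b, ind, Set.indicator, k1, k2]
  rw [e1]
  have i1 : Integrable (fun x => c * emb qi (a x)) :=
    ((emb qi).integrable_comp ha).const_mul c
  have i2 : Integrable (fun x => emb qj (b x)) := (emb qj).integrable_comp hb
  have := integral_prod_bilin (ContinuousLinearMap.mul ℝ Hq) i1 i2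
  simp only [ContinuousLinearMap.mul_apply'] at this
  rw [Measure.volume_eq_prod, this, integral_const_mul_of_integrable ((emb qi).integrable_comp ha),
    (emb qi).integral_comp_comm ha, (emb qj).integral_comp_comm hb]
  rfl

lemma integrable_mul_star (f g : Lp Hq 2 (volume : Measure (ℝ × ℝ))) :
    Integrable (fun x => f x * star (g x)) :=
  (Lp.memLp f).integrable_mul (Lp.memLp g).star

/-- Left multiplication by a quaternion on `L²`. -/
def Lmul (c : Hq) : Lp Hq 2 (volume : Measure (ℝ × ℝ)) →L[ℝ] Lp Hq 2 (volume : Measure (ℝ × ℝ)) :=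
  (ContinuousLinearMap.mul ℝ Hq c).compLpL 2 volume

/-- Real part as a continuous linear map. -/
def reL : Hq →L[ℝ] ℝ := innerSL ℝ (1 : Hq)

lemma reL_apply (q : Hq) : reL q = q.re := by
  change inner ℝ (1 : Hq) q = q.re
  rw [Quaternion.inner_def, one_mul, Quaternion.re_star]

lemma inner_Lmul (c : Hq) (f g : Lp Hq 2 (volume : Measure (ℝ × ℝ))) :
    inner ℝ (Lmul c f) g = (c * ∫ x, f x * star (g x)).re := by
  rw [L2.inner_def, ← integral_const_mul_of_integrable (integrable_mul_star f g), ← reL_apply,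
    ← reL.integral_comp_comm ((integrable_mul_star f g).const_mul c)]
  apply integral_congr_ae
  filter_upwards [ContinuousLinearMap.coeFn_compLpL (p := 2) (μ := volume)
    (ContinuousLinearMap.mul ℝ Hq c) f] with x hx
  have hx' : (Lmul c f) x = c * f x := hx
  rw [hx', Quaternion.inner_def, reL_apply, mul_assoc]

lemma quat_ext_mul {p q : Hq} (h : ∀ c : Hq, (c * p).re = (c * q).re) : p = q := by
  have := h (star (p - q))
  have h2 : (star (p - q) * (p - q)).re = 0 := by
    rw [mul_sub, Quaternion.re_sub, this, sub_self]
  rw [Quaternion.star_mul_self, Quaternion.re_coe] at h2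
  exact sub_eq_zero.1 (Quaternion.normSq_eq_zero.1 h2)

lemma integral_rect {A B A' B' : Set ℝ} (hA : MeasurableSet A) (hB : MeasurableSet B)
    (hA' : MeasurableSet A') (hB' : MeasurableSet B')
    (hAB : volume (A ×ˢ B) ≠ ∞) (hAB' : volume (A' ×ˢ B') ≠ ∞) (a b : Hq) :
    ∫ x, (indicatorConstLp 2 (hA.prod hB) hAB a : Lp Hq 2 (volume : Measure (ℝ × ℝ))) x *
      star ((indicatorConstLp 2 (hA'.prod hB') hAB' b : Lp Hq 2 (volume : Measure (ℝ × ℝ))) x)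
      = (volume.real (A ∩ A') * volume.real (B ∩ B')) • (a * star b) := by
  have : ∫ x, (indicatorConstLp 2 (hA.prod hB) hAB a : Lp Hq 2 (volume : Measure (ℝ × ℝ))) x *
      star ((indicatorConstLp 2 (hA'.prod hB') hAB' b : Lp Hq 2 (volume : Measure (ℝ × ℝ))) x)
      = ∫ x, ((A ∩ A') ×ˢ (B ∩ B')).indicator (fun _ => a * star b) x := by
    apply integral_congr_ae
    filter_upwards [indicatorConstLp_coeFn (p := 2) (hs := hA.prod hB) (hμs := hAB) (c := a),
      indicatorConstLp_coeFn (p := 2) (hs := hA'.prod hB') (hμs := hAB') (c := b)] with x h1 h2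
    rw [h1, h2, ← Set.prod_inter_prod]
    by_cases k1 : x ∈ A ×ˢ B <;> by_cases k2 : x ∈ A' ×ˢ B' <;>
      simp only [Set.indicator, Set.mem_inter_iff, k1, k2, if_true, if_false, and_self, and_true,
        and_false, star_zero, mul_zero, zero_mul]
  rw [this, integral_indicator ((hA.inter hA').prod (hB.inter hB')), setIntegral_const,
    Measure.volume_eq_prod, measureReal_prod_prod]

lemma conj_integral (k k' : Hq) (u : Hq) {z : ℝ → ℂ} (hz : Integrable z) {r : ℝ}
    (hr : ∫ ω, z ω = (r : ℂ)) : ∫ ω, k * emb u (z ω) * k' = r • (k * k') := by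
  have h1 : Integrable (fun ω => emb u (z ω)) := (emb u).integrable_comp hz
  rw [integral_mul_const_of_integrable (h1.const_mul k), integral_const_mul_of_integrable h1,
    (emb u).integral_comp_comm hz, hr, emb_real]
  rw [mul_smul_comm, mul_one, smul_mul_assoc]

lemma integral_hat_ind {A A' : Set ℝ} (hA : MeasurableSet A) (hA' : MeasurableSet A')
    (h : volume A ≠ ∞) (h' : volume A' ≠ ∞) :
    ∫ ω, hat (ind A) ω * star (hat (ind A') ω) = ((2 * π * volume.real (A ∩ A') : ℝ) : ℂ) := by
  rw [integral_hat (ind_integrable hA h) (ind_memLp hA h) (ind_integrable hA' h')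
    (ind_memLp hA' h'), ind_integral hA hA']
  simp

lemma gen_alg (s : ℝ) (a b x y z w : Hq) :
    (s • (a * x * y)) * star (s • (b * z * w)) =
      (s * s) • (a * x * (y * star w) * (star z * star b)) := by
  have h : star (s • (b * z * w)) = s • star (b * z * w) := Quaternion.star_smul s _
  rw [h, smul_mul_assoc, mul_smul_comm, smul_smul, star_mul, star_mul]
  simp only [mul_assoc]

lemma gen_eq (Ψ : Lp Hq 2 (volume : Measure (ℝ × ℝ)) → Lp Hq 2 (volume : Measure (ℝ × ℝ)))
    (hagree : ∀ f : Lp Hq 2 (volume : Measure (ℝ × ℝ)),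
      Integrable (f : ℝ × ℝ → Hq) → (Ψ f : ℝ × ℝ → Hq) =ᵐ[volume] Fr f)
    (hI : ∀ p ∈ rectSet, Integrable (p : ℝ × ℝ → Hq))
    {p q : Lp Hq 2 (volume : Measure (ℝ × ℝ))} (hp : p ∈ rectSet) (hq : q ∈ rectSet) :
    ∫ ω, (Ψ p) ω * star ((Ψ q) ω) = ∫ x, p x * star (q x) := by
  have ep := hagree p (hI p hp)
  have eqq := hagree q (hI q hq)
  obtain ⟨A, B, hA, hB, fA, fB, hAB, a, rfl⟩ := hp
  obtain ⟨A', B', hA', hB', fA', fB', hAB', b, rfl⟩ := hq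
  rw [integral_rect hA hB hA' hB']
  set P := Ψ (indicatorConstLp 2 (hA.prod hB) hAB a)
  set Q := Ψ (indicatorConstLp 2 (hA'.prod hB') hAB' b)
  let s : ℝ := 1 / (2 * Real.pi)
  have e : (fun ω => P ω * star (Q ω)) =ᵐ[volume] fun ω : ℝ × ℝ =>
      (s * s) • ((a * emb qi (hat (ind A) ω.1)) *
        emb qj (hat (ind B) ω.2 * star (hat (ind B') ω.2)) *
        (star (emb qi (hat (ind A') ω.1)) * star b)) := by
    filter_upwards [ep, eqq] with ω h1 h2
    rw [h1, h2, Fr_rect hA hB fA fB, Fr_rect hA' hB' fA' fB', ← emb_mul_qj, ← emb_star_qj]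
    exact gen_alg s a b _ _ _ _
  have hint := (integrable_congr e).1 (integrable_mul_star P Q)
  rw [integral_congr_ae e]
  rw [Measure.volume_eq_prod] at hint ⊢
  rw [integral_prod _ hint]
  have inner_eq : ∀ x : ℝ, (∫ y : ℝ, (s * s) • ((a * emb qi (hat (ind A) x)) *
        emb qj (hat (ind B) y * star (hat (ind B') y)) *
        (star (emb qi (hat (ind A') x)) * star b))) =
      (s * s * (2 * π * volume.real (B ∩ B'))) •
        (a * emb qi (hat (ind A) x * star (hat (ind A') x)) * star b) := by
    intro x
    rw [integral_smul, conj_integral _ _ _ (integrable_hat (ind_integrable hB fB) (ind_memLp hB fB)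
      (ind_integrable hB' fB') (ind_memLp hB' fB')) (integral_hat_ind hB hB' fB fB'), smul_smul,
      ← emb_mul_qi, ← emb_star_qi]
    simp only [mul_assoc]
  simp only [inner_eq]
  rw [integral_smul, conj_integral _ _ _ (integrable_hat (ind_integrable hA fA) (ind_memLp hA fA)
      (ind_integrable hA' fA') (ind_memLp hA' fA')) (integral_hat_ind hA hA' fA fA'), smul_smul]
  congr 1
  simp only [s]
  field_simp

lemma rect_integrable : ∀ p ∈ rectSet, Integrable (p : ℝ × ℝ → Hq) := by
  rintro _ ⟨A, B, hA, hB, fA, fB, hAB, a, rfl⟩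
  refine Integrable.congr ?_ (indicatorConstLp_coeFn (p := 2) (hs := hA.prod hB) (hμs := hAB)
    (c := a)).symm
  exact (integrable_indicator_iff (hA.prod hB)).2 (integrableOn_const hAB)

lemma span_integrable : ∀ p ∈ Submodule.span ℝ rectSet, Integrable (p : ℝ × ℝ → Hq) := by
  intro p hp
  induction hp using Submodule.span_induction with
  | mem x h => exact rect_integrable x h
  | zero => exact (integrable_zero (ℝ × ℝ) Hq volume).congr (Lp.coeFn_zero Hq 2 volume).symm
  | add x y _ _ hx hy => exact (hx.add hy).congr (Lp.coeFn_add x y).symm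
  | smul c x _ hx => exact (hx.smul c).congr (Lp.coeFn_smul c x).symm

lemma qexp_norm_le (u : Hq) (hu : ‖u‖ ≤ 1) (θ : ℝ) : ‖qexp u θ‖ ≤ 2 := by
  unfold qexp
  calc _ ≤ ‖Real.cos θ • (1 : Hq)‖ + ‖Real.sin θ • u‖ := norm_add_le _ _
    _ ≤ 1 + 1 := by
      rw [norm_smul, norm_smul, norm_one, mul_one]
      gcongr
      · exact Real.abs_cos_le_one θ
      · calc _ ≤ 1 * (1 : ℝ) := by
              gcongr
              exact Real.abs_sin_le_one θ
          _ = 1 := one_mul 1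
    _ = 2 := by norm_num

lemma norm_qi : ‖qi‖ ≤ 1 := by
  have : ‖qi‖ * ‖qi‖ = 1 := by
    rw [← Quaternion.normSq_eq_norm_mul_self, Quaternion.normSq_def']
    simp [qi]
  nlinarith [norm_nonneg qi]

lemma norm_qj : ‖qj‖ ≤ 1 := by
  have : ‖qj‖ * ‖qj‖ = 1 := by
    rw [← Quaternion.normSq_eq_norm_mul_self, Quaternion.normSq_def']
    simp [qj]
  nlinarith [norm_nonneg qj]

lemma kernel_integrable {f : ℝ × ℝ → Hq} (hf : Integrable f) (ω : ℝ × ℝ) :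
    Integrable (fun x : ℝ × ℝ => f x * qexp qi (-(ω.1 * x.1)) * qexp qj (-(ω.2 * x.2))) := by
  refine Integrable.mul_bdd (c := 2) (Integrable.mul_bdd (c := 2) hf ?_ ?_) ?_ ?_
  · refine Continuous.aestronglyMeasurable ?_
    unfold qexp; fun_prop
  · exact Filter.Eventually.of_forall fun x => qexp_norm_le _ norm_qi _
  · refine Continuous.aestronglyMeasurable ?_
    unfold qexp; fun_prop
  · exact Filter.Eventually.of_forall fun x => qexp_norm_le _ norm_qj _

lemma Fr_congr {f g : ℝ × ℝ → Hq} (h : f =ᵐ[volume] g) : Fr f = Fr g := by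
  ext1 ω
  unfold Fr
  congr 1
  apply integral_congr_ae
  filter_upwards [h] with x hx
  rw [hx]

lemma Fr_add {f g : ℝ × ℝ → Hq} (hf : Integrable f) (hg : Integrable g) :
    Fr (f + g) = Fr f + Fr g := by
  ext1 ω
  rw [Pi.add_apply]
  unfold Fr
  rw [← smul_add, ← integral_add (kernel_integrable hf ω) (kernel_integrable hg ω)]
  simp only [Pi.add_apply, add_mul]

lemma Fr_smul (c : ℝ) (f : ℝ × ℝ → Hq) : Fr (c • f) = c • Fr f := by
  ext1 ω
  rw [Pi.smul_apply]
  unfold Fr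
  rw [smul_comm c, ← integral_smul c]
  simp only [Pi.smul_apply, smul_mul_assoc]

theorem stmt8 (Ψ : Lp Hq 2 (volume : Measure (ℝ × ℝ)) → Lp Hq 2 (volume : Measure (ℝ × ℝ)))
    (hcont : Continuous Ψ)
    (hagree : ∀ f : Lp Hq 2 (volume : Measure (ℝ × ℝ)),
      Integrable (f : ℝ × ℝ → Hq) → (Ψ f : ℝ × ℝ → Hq) =ᵐ[volume] Fr f)
    (f g : Lp Hq 2 (volume : Measure (ℝ × ℝ))) :
    (∫ x : ℝ × ℝ, f x * star (g x)) = ∫ ω : ℝ × ℝ, (Ψ f) ω * star ((Ψ g) ω) := by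
  have hadd : ∀ f g, Ψ (f + g) = Ψ f + Ψ g := by
    have := eqOn_closure₂' (s := (Submodule.span ℝ rectSet : Set _))
      (t := (Submodule.span ℝ rectSet : Set _)) (f := fun f g => Ψ (f + g))
      (g := fun f g => Ψ f + Ψ g) ?_ (fun x => by fun_prop) (fun x => by fun_prop)
      (fun x => by fun_prop) (fun x => by fun_prop)
    · exact fun f g => this f (dense_rect f) g (dense_rect g)
    · intro p hp q hq
      have ip := span_integrable p hp
      have iq := span_integrable q hq
      apply Lp.ext
      filter_upwards [hagree p ip, hagree q iq, hagree (p + q)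
        (span_integrable _ (Submodule.add_mem _ hp hq)), Lp.coeFn_add (Ψ p) (Ψ q)] with x a b c d
      rw [c, d, Pi.add_apply, a, b, Fr_congr (Lp.coeFn_add p q), Fr_add ip iq, Pi.add_apply]
  have hsmul : ∀ (c : ℝ) f, Ψ (c • f) = c • Ψ f := by
    intro c
    have := Continuous.ext_on dense_rect (f := fun f => Ψ (c • f)) (g := fun f => c • Ψ f)
      (by fun_prop) (by fun_prop) ?_
    · exact fun f => congrFun this f
    · intro p hp
      have ip := span_integrable p hp
      apply Lp.ext
      filter_upwards [hagree p ip, hagree (c • p)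
        (span_integrable _ (Submodule.smul_mem _ c hp)), Lp.coeFn_smul c (Ψ p)] with x a b d
      rw [b, d, Pi.smul_apply, a, Fr_congr (Lp.coeFn_smul c p), Fr_smul, Pi.smul_apply]
  let Φ : Lp Hq 2 (volume : Measure (ℝ × ℝ)) →L[ℝ] Lp Hq 2 (volume : Measure (ℝ × ℝ)) :=
    { toFun := Ψ, map_add' := hadd, map_smul' := hsmul, cont := hcont }
  have hΦ : ∀ f, Φ f = Ψ f := fun _ => rfl
  apply quat_ext_mul
  intro c
  rw [← inner_Lmul, ← inner_Lmul]
  have s1 : ∀ p ∈ rectSet, ∀ g, inner ℝ (Lmul c p) g = inner ℝ (Lmul c (Φ p)) (Φ g) := by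
    intro p hp g
    have : innerSL ℝ (Lmul c p) = (innerSL ℝ (Lmul c (Φ p))).comp Φ := by
      apply ContinuousLinearMap.ext_on dense_rect
      intro q hq
      change inner ℝ (Lmul c p) q = inner ℝ (Lmul c (Φ p)) (Φ q)
      rw [inner_Lmul, inner_Lmul, hΦ, hΦ, gen_eq Ψ hagree rect_integrable hp hq]
    exact congrArg (fun T => T g) this
  have : (innerSL ℝ g).comp (Lmul c) = (innerSL ℝ (Φ g)).comp ((Lmul c).comp Φ) := by
    apply ContinuousLinearMap.ext_on dense_rect
    intro p hp
    change inner ℝ g (Lmul c p) = inner ℝ (Φ g) (Lmul c (Φ p))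
    rw [real_inner_comm, s1 p hp g, real_inner_comm]
  have h2 : inner ℝ g (Lmul c f) = inner ℝ (Φ g) (Lmul c (Φ f)) :=
    congrArg (fun T => T f) this
  rw [real_inner_comm, h2, real_inner_comm]
  rfl
end
end

section
/- (Inversion of the SQLCT.) Let A₁ = (a₁ b₁; c₁ d₁) and A₂ = (a₂ b₂; c₂ d₂) be real 2×2 matrices with det A₁ = det A₂ = 1 and b₁, b₂ ≠ 0. If f ∈ L¹(ℝ²,ℍ) and ℒ_s f ∈ L¹(ℝ²,ℍ), then f(x₁,x₂) = ∫_{ℝ²} K_{A₁^{-1}}^i(ω₁,x₁) (ℒ_s f)(ω₁,ω₂) K_{A₂^{-1}}^j(ω₂,x₂) dω₁ dω₂ for almost every (x₁,x₂) ∈ ℝ², where A^{-1} = (d −b; −c a) for A = (a b; c d) with det A = 1. -/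
open MeasureTheory Real ENNReal

noncomputable section

/-- The LCT kernel K_A^u for a matrix A = (a b; c d) with b ≠ 0, evaluated at (x, ω). -/
def Kker (u : Hq) (a b d : ℝ) (x ω : ℝ) : Hq :=
  (Real.sqrt (2 * Real.pi * |b|))⁻¹ •
    (qexp u (-(Real.pi * Real.sign b / 4)) *
      qexp u (a * x ^ 2 / (2 * b) - x * ω / b + d * ω ^ 2 / (2 * b)))

/-- The two-sided quaternion linear canonical transform (case b₁, b₂ ≠ 0). -/
def Ls (a1 b1 d1 a2 b2 d2 : ℝ) (f : ℝ × ℝ → Hq) (ω : ℝ × ℝ) : Hq :=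
  ∫ x : ℝ × ℝ, Kker qi a1 b1 d1 x.1 ω.1 * f x * Kker qj a2 b2 d2 x.2 ω.2

/-- The right-sided quaternion linear canonical transform (case b₁, b₂ ≠ 0). -/
def Lr (a1 b1 d1 a2 b2 d2 : ℝ) (f : ℝ × ℝ → Hq) (ω : ℝ × ℝ) : Hq :=
  ∫ x : ℝ × ℝ, f x * Kker qi a1 b1 d1 x.1 ω.1 * Kker qj a2 b2 d2 x.2 ω.2

open scoped FourierTransform
open scoped ContDiff in
lemma ae_inv {V : Type*} [NormedAddCommGroup V] [InnerProductSpace ℝ V] [FiniteDimensional ℝ V]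
   [MeasurableSpace V] [BorelSpace V] (f : V → ℂ) (hf : Integrable f) (hF : Integrable (𝓕 f)) :
   ∀ᵐ x, f x = 𝓕⁻ (𝓕 f) x := by
  have key : ∀ (f g : V → ℂ), Integrable f → Integrable g → ∫ x, 𝓕 f x * g x = ∫ x, f x * 𝓕 g x := by
    intro f g hf hg
    have := VectorFourier.integral_fourierIntegral_smul_eq_flip (L := innerₗ V) (μ := volume) (ν := volume)
      Real.continuous_fourierChar continuous_inner hf hg
    simpa [flip_innerₗ] using! this
  have keyinv : ∀ (f g : V → ℂ), Integrable f → Integrable g → ∫ x, 𝓕⁻ f x * g x = ∫ x, f x * 𝓕⁻ g x := by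
    intro f g hf hg
    rw [Real.fourierInv_eq_fourier_comp_neg f]
    rw [key _ _ hf.comp_neg hg, ← integral_neg_eq_self]
    congr 1; ext x
    simp [Real.fourierInv_eq_fourier_neg]
  have hcont : Continuous (𝓕⁻ (𝓕 f)) := by
    have := VectorFourier.fourierIntegral_continuous (L := innerₗ V) (μ := volume) 
      Real.continuous_fourierChar continuous_inner hF
    have h2 := this.comp continuous_neg
    convert h2 using 1
    ext x
    rw [Real.fourierInv_eq_fourier_neg]; rfl
  refine ae_eq_of_integral_contDiff_smul_eq hf.locallyIntegrable hcont.locallyIntegrable ?_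
  intro g hg hgc
  have hg₁ : HasCompactSupport (Complex.ofRealCLM ∘ g) := hgc.comp_left rfl
  have hg₂ : ContDiff ℝ ∞ (Complex.ofRealCLM ∘ g) := by fun_prop
  set G : SchwartzMap V ℂ := hg₁.toSchwartzMap hg₂
  have hG : ∀ x, (g x : ℂ) = G x := fun x => rfl
  have hI : (𝓕 (𝓕⁻ (G : V → ℂ))) = G := by
    rw [← SchwartzMap.fourierInv_coe, ← SchwartzMap.fourier_coe, FourierTransform.fourier_fourierInv_eq]
  have hIi : Integrable (𝓕⁻ (G : V → ℂ)) := by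
    rw [← SchwartzMap.fourierInv_coe]; exact SchwartzMap.integrable _
  have := keyinv _ _ hF G.integrable
  rw [key _ _ hf hIi, hI] at this
  simp only [Complex.real_smul, hG]
  simp_rw [mul_comm (G _)]
  exact this.symm
lemma scale (c1 c2 : ℝ) (h1 : c1 ≠ 0) (h2 : c2 ≠ 0) :
   Measure.map (fun x : ℝ × ℝ => (c1 * x.1, c2 * x.2)) volume = ENNReal.ofReal (|c1|⁻¹ * |c2|⁻¹) • volume := by
  have := Measure.map_prod_map (volume : Measure ℝ) (volume : Measure ℝ) (f := fun x => c1 * x) (g := fun x => c2 * x) (by fun_prop) (by fun_prop)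
  rw [Real.map_volume_mul_left h1, Real.map_volume_mul_left h2] at this
  change Measure.map (Prod.map (c1 * ·) (c2 * ·)) (volume.prod volume) = _ • (volume.prod volume)
  rw [← this, Measure.prod_smul_left, Measure.prod_smul_right, smul_smul, ← ENNReal.ofReal_mul (by positivity)]
  simp [abs_inv]

lemma scale_int (c1 c2 : ℝ) (h1 : c1 ≠ 0) (h2 : c2 ≠ 0) (H : ℝ × ℝ → ℂ) :
    ∫ x : ℝ × ℝ, H (c1 * x.1, c2 * x.2) = ((|c1|⁻¹ * |c2|⁻¹ : ℝ) : ℂ) * ∫ x, H x := by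
  have e : MeasurableEmbedding (fun x : ℝ × ℝ => (c1 * x.1, c2 * x.2)) :=
    (measurableEmbedding_mulLeft₀ h1).prodMap (measurableEmbedding_mulLeft₀ h2)
  have := e.integral_map (μ := volume) H
  rw [← this, scale c1 c2 h1 h2, integral_smul_measure, ENNReal.toReal_ofReal (by positivity)]
  simp

lemma scale_integrable (c1 c2 : ℝ) (h1 : c1 ≠ 0) (h2 : c2 ≠ 0) (H : ℝ × ℝ → ℂ) (hH : Integrable H) :
    Integrable (fun x : ℝ × ℝ => H (c1 * x.1, c2 * x.2)) := by
  have e : MeasurableEmbedding (fun x : ℝ × ℝ => (c1 * x.1, c2 * x.2)) :=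
    (measurableEmbedding_mulLeft₀ h1).prodMap (measurableEmbedding_mulLeft₀ h2)
  have := (e.integrable_map_iff (μ := volume) (g := H)).1
  apply this
  rw [scale c1 c2 h1 h2]
  exact hH.smul_measure ENNReal.ofReal_ne_top

lemma inv2 (b1 b2 : ℝ) (h1 : b1 ≠ 0) (h2 : b2 ≠ 0) (h H : ℝ × ℝ → ℂ) (hh : Integrable h)
    (hH : Integrable H)
    (e : ∀ ω : ℝ × ℝ, H ω = ∫ x : ℝ × ℝ,
      Complex.exp ((-(x.1 * ω.1 / b1 + x.2 * ω.2 / b2) : ℝ) * Complex.I) * h x) :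
    ∀ᵐ x : ℝ × ℝ, h x = (((2 * π * |b1|)⁻¹ * (2 * π * |b2|)⁻¹ : ℝ) : ℂ) * ∫ ω : ℝ × ℝ,
      Complex.exp (((x.1 * ω.1 / b1 + x.2 * ω.2 / b2) : ℝ) * Complex.I) * H ω := by
  have ho := WithLp.volume_preserving_ofLp ℝ ℝ
  have ht := WithLp.volume_preserving_toLp ℝ ℝ
  have hoe : MeasurableEmbedding (@WithLp.ofLp 2 (ℝ × ℝ)) :=
    (MeasurableEquiv.toLp 2 (ℝ × ℝ)).symm.measurableEmbedding
  have hπ := Real.pi_ne_zero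
  have hF : ∀ w : WithLp 2 (ℝ × ℝ), 𝓕 (fun v : WithLp 2 (ℝ × ℝ) => h v.ofLp) w
      = H (2 * π * b1 * w.ofLp.1, 2 * π * b2 * w.ofLp.2) := by
    intro w
    rw [Real.fourier_eq', e, ← ho.integral_comp hoe]
    congr 1; ext v
    simp only [smul_eq_mul, WithLp.prod_inner_apply]
    congr 4
    simp
    field_simp
    ring
  have hF' := funext hF
  have hSi := scale_integrable (2 * π * b1) (2 * π * b2) (by positivity) (by positivity) H hH
  have main := ae_inv (fun v : WithLp 2 (ℝ × ℝ) => h v.ofLp) (ho.integrable_comp_of_integrable hh) (by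
    rw [hF']
    exact ho.integrable_comp_of_integrable hSi)
  have m2 := ht.quasiMeasurePreserving.ae main
  filter_upwards [m2] with x hx
  rw [hF'] at hx
  change h x = _ at hx
  rw [hx, Real.fourierInv_eq']
  have := scale_int (2 * π * b1) (2 * π * b2) (by positivity) (by positivity) (fun ω : ℝ × ℝ =>
      Complex.exp (((x.1 * ω.1 / b1 + x.2 * ω.2 / b2) : ℝ) * Complex.I) * H ω)
  have hp : |2 * π| = 2 * π := abs_of_pos (by positivity)
  rw [abs_mul, abs_mul (2 * π) b2, hp] at this
  rw [← this, ← ho.integral_comp hoe]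
  congr 1; ext v
  simp only [smul_eq_mul, WithLp.prod_inner_apply]
  congr 4
  simp
  field_simp

lemma inv3 (b1 b2 : ℝ) (h1 : b1 ≠ 0) (h2 : b2 ≠ 0) (u v : ℝ × ℝ → ℝ) (hu : Continuous u)
    (hv : Continuous v) (C : ℝ) (hC : C ^ 2 = (2 * π * |b1|)⁻¹ * (2 * π * |b2|)⁻¹)
    (g G : ℝ × ℝ → ℂ) (hg : Integrable g) (hG : Integrable G)
    (e : ∀ ω : ℝ × ℝ, G ω = ∫ x : ℝ × ℝ,
      C * Complex.exp ((u x + v ω - (x.1 * ω.1 / b1 + x.2 * ω.2 / b2) : ℝ) * Complex.I) * g x) :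
    ∀ᵐ x : ℝ × ℝ, g x = ∫ ω : ℝ × ℝ,
      C * Complex.exp ((-(u x + v ω - (x.1 * ω.1 / b1 + x.2 * ω.2 / b2)) : ℝ) * Complex.I) * G ω := by
  have hC0 : (C : ℂ) ≠ 0 := by
    have : C ^ 2 ≠ 0 := by rw [hC]; have := Real.pi_ne_zero; positivity
    intro h; apply this; rw [Complex.ofReal_eq_zero] at h; simp [h]
  have bd : ∀ (w : ℝ × ℝ → ℝ), Continuous w → ∀ g : ℝ × ℝ → ℂ, Integrable g →
      Integrable (fun x => Complex.exp ((w x : ℝ) * Complex.I) * g x) := by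
    intro w hw g hg
    refine hg.bdd_mul (c := 1) ?_ ?_
    · exact Continuous.aestronglyMeasurable (by fun_prop)
    · refine Filter.Eventually.of_forall fun x => ?_
      rw [Complex.norm_exp_ofReal_mul_I]
  have := inv2 b1 b2 h1 h2 (fun x => Complex.exp (u x * Complex.I) * g x)
    (fun ω => (C : ℂ)⁻¹ * (Complex.exp ((-v ω : ℝ) * Complex.I) * G ω)) (bd u hu g hg)
    ((bd (fun ω => - v ω) hv.neg G hG).const_mul _) (by
      intro ω
      rw [e, ← integral_const_mul, ← integral_const_mul]
      congr 1; ext x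
      have : ∀ p q : ℂ, (C:ℂ)⁻¹ * (p * (C * q * g x)) = (p * q) * g x := by
        intro p q; field_simp
      rw [this, ← Complex.exp_add, ← mul_assoc, ← Complex.exp_add]
      congr 2; push_cast; ring)
  filter_upwards [this] with x hx
  rw [← hC] at hx
  have h3 : g x = Complex.exp ((-u x : ℝ) * Complex.I) * (Complex.exp (u x * Complex.I) * g x) := by
    rw [← mul_assoc, ← Complex.exp_add]; simp
  rw [h3, hx, ← integral_const_mul, ← integral_const_mul]
  congr 1; ext ω
  have : ∀ p q r: ℂ, r * ((C^2 : ℝ) * (p * ((C:ℂ)⁻¹ * (q * G ω)))) = C * (r * p * q) * G ω := by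
    intro p q r; push_cast; field_simp
  rw [this, ← Complex.exp_add, ← Complex.exp_add]
  congr 3; push_cast; ring

/-- The (real-linear) components splitting the two-sided action of `i` and `j`. -/
def Pcomp (ε : ℝ) : Hq →L[ℝ] ℂ := LinearMap.toContinuousLinearMap
  { toFun := fun q => ⟨q.re - ε * q.imK, q.imI + ε * q.imJ⟩
    map_add' := by intro p q; apply Complex.ext <;> simp <;> ring
    map_smul' := by intro p q; apply Complex.ext <;> simp <;> ring }

lemma Pcomp_apply (ε : ℝ) (q : Hq) : Pcomp ε q = ⟨q.re - ε * q.imK, q.imI + ε * q.imJ⟩ := rfl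

lemma Pcomp_inj (p q : Hq) (h1 : Pcomp 1 p = Pcomp 1 q) (h2 : Pcomp (-1) p = Pcomp (-1) q) :
    p = q := by
  simp only [Pcomp_apply, Complex.mk.injEq] at h1 h2
  obtain ⟨h1, h1'⟩ := h1
  obtain ⟨h2, h2'⟩ := h2
  ext <;> linarith

lemma qexp_qi (θ : ℝ) : qexp qi θ = ⟨Real.cos θ, Real.sin θ, 0, 0⟩ := by
  have h : (⟨Real.cos θ, Real.sin θ, 0, 0⟩ : Hq) = (⟨Real.cos θ * 1 + Real.sin θ * 0,
      Real.cos θ * 0 + Real.sin θ * 1, Real.cos θ * 0 + Real.sin θ * 0,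
      Real.cos θ * 0 + Real.sin θ * 0⟩ : Hq) := by simp
  rw [h]; rfl

lemma qexp_qj (θ : ℝ) : qexp qj θ = ⟨Real.cos θ, 0, Real.sin θ, 0⟩ := by
  have h : (⟨Real.cos θ, 0, Real.sin θ, 0⟩ : Hq) = (⟨Real.cos θ * 1 + Real.sin θ * 0,
      Real.cos θ * 0 + Real.sin θ * 0, Real.cos θ * 0 + Real.sin θ * 1,
      Real.cos θ * 0 + Real.sin θ * 0⟩ : Hq) := by simp
  rw [h]; rfl

lemma qi_re (θ : ℝ) : (qexp qi θ).re = Real.cos θ := by rw [qexp_qi]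
lemma qi_imI (θ : ℝ) : (qexp qi θ).imI = Real.sin θ := by rw [qexp_qi]
lemma qi_imJ (θ : ℝ) : (qexp qi θ).imJ = 0 := by rw [qexp_qi]
lemma qi_imK (θ : ℝ) : (qexp qi θ).imK = 0 := by rw [qexp_qi]
lemma qj_re (θ : ℝ) : (qexp qj θ).re = Real.cos θ := by rw [qexp_qj]
lemma qj_imI (θ : ℝ) : (qexp qj θ).imI = 0 := by rw [qexp_qj]
lemma qj_imJ (θ : ℝ) : (qexp qj θ).imJ = Real.sin θ := by rw [qexp_qj]
lemma qj_imK (θ : ℝ) : (qexp qj θ).imK = 0 := by rw [qexp_qj]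

lemma Pcomp_exp (ε : ℝ) (hε : ε = 1 ∨ ε = -1) (α β : ℝ) (q : Hq) :
    Pcomp ε (qexp qi α * q * qexp qj β) =
      Complex.exp ((α + ε * β : ℝ) * Complex.I) * Pcomp ε q := by
  rw [Complex.exp_mul_I, ← Complex.ofReal_cos, ← Complex.ofReal_sin, Real.cos_add, Real.sin_add]
  rcases hε with rfl | rfl <;> apply Complex.ext <;>
    simp [Pcomp_apply, Quaternion.re_mul, Quaternion.imI_mul, Quaternion.imJ_mul, Quaternion.imK_mul,
      qi_re, qi_imI, qi_imJ, qi_imK, qj_re, qj_imI, qj_imJ, qj_imK, -Complex.ofReal_cos, -Complex.ofReal_sin] <;> ring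

lemma qexp_add_i (α β : ℝ) : qexp qi α * qexp qi β = qexp qi (α + β) := by
  ext <;> simp [Quaternion.re_mul, Quaternion.imI_mul, Quaternion.imJ_mul, Quaternion.imK_mul, qi_re, qi_imI, qi_imJ, qi_imK, Real.cos_add, Real.sin_add] <;> ring

lemma qexp_add_j (α β : ℝ) : qexp qj α * qexp qj β = qexp qj (α + β) := by
  ext <;> simp [Quaternion.re_mul, Quaternion.imI_mul, Quaternion.imJ_mul, Quaternion.imK_mul, qj_re, qj_imI, qj_imJ, qj_imK, Real.cos_add, Real.sin_add] <;> ring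

lemma Pcomp_ker (ε : ℝ) (hε : ε = 1 ∨ ε = -1) (a1 b1 d1 a2 b2 d2 x1 w1 x2 w2 : ℝ) (q : Hq) :
    Pcomp ε (Kker qi a1 b1 d1 x1 w1 * q * Kker qj a2 b2 d2 x2 w2) =
      (((Real.sqrt (2 * Real.pi * |b1|))⁻¹ * (Real.sqrt (2 * Real.pi * |b2|))⁻¹ : ℝ) : ℂ) *
      Complex.exp (((-(Real.pi * Real.sign b1 / 4) +
        (a1 * x1 ^ 2 / (2 * b1) - x1 * w1 / b1 + d1 * w1 ^ 2 / (2 * b1))) +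
        ε * (-(Real.pi * Real.sign b2 / 4) +
        (a2 * x2 ^ 2 / (2 * b2) - x2 * w2 / b2 + d2 * w2 ^ 2 / (2 * b2))) : ℝ) * Complex.I) *
      Pcomp ε q := by
  rw [Kker, Kker, qexp_add_i, qexp_add_j, smul_mul_assoc, smul_mul_assoc, mul_smul_comm,
    map_smul, map_smul, Pcomp_exp ε hε, Complex.real_smul, Complex.real_smul]
  push_cast
  ring

lemma continuous_Kker_left (u : Hq) (a b d w : ℝ) : Continuous (fun x => Kker u a b d x w) := by
  unfold Kker qexp
  fun_prop

lemma norm_Kker_le (u : Hq) (a b d : ℝ) : ∃ c : ℝ, ∀ x w, ‖Kker u a b d x w‖ ≤ c := by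
  have hb : ∀ θ, ‖qexp u θ‖ ≤ 1 + ‖u‖ := by
    intro θ
    refine (norm_add_le _ _).trans ?_
    rw [norm_smul, norm_smul, norm_one, Real.norm_eq_abs, Real.norm_eq_abs]
    have := Real.abs_cos_le_one θ
    have := mul_le_mul_of_nonneg_right (Real.abs_sin_le_one θ) (norm_nonneg u)
    linarith
  refine ⟨‖(Real.sqrt (2 * Real.pi * |b|))⁻¹‖ * ((1 + ‖u‖) * (1 + ‖u‖)), fun x w => ?_⟩
  rw [Kker, norm_smul, norm_mul]
  gcongr <;> apply hb

lemma integrable_Kker (a1 b1 d1 a2 b2 d2 : ℝ) (w : ℝ × ℝ) (f : ℝ × ℝ → Hq) (hf : Integrable f) :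
    Integrable (fun x : ℝ × ℝ => Kker qi a1 b1 d1 x.1 w.1 * f x * Kker qj a2 b2 d2 x.2 w.2) := by
  obtain ⟨c1, h1⟩ := norm_Kker_le qi a1 b1 d1
  obtain ⟨c2, h2⟩ := norm_Kker_le qj a2 b2 d2
  refine Integrable.mul_bdd (c := c2) (hf.bdd_mul (c := c1) ?_ ?_) ?_ ?_
  · exact ((continuous_Kker_left _ _ _ _ _).comp continuous_fst).aestronglyMeasurable
  · exact Filter.Eventually.of_forall fun x => h1 _ _
  · exact ((continuous_Kker_left _ _ _ _ _).comp continuous_snd).aestronglyMeasurable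
  · exact Filter.Eventually.of_forall fun x => h2 _ _

lemma Pcomp_main (ε : ℝ) (hε : ε = 1 ∨ ε = -1) (a1 b1 d1 a2 b2 d2 : ℝ)
    (hb1 : b1 ≠ 0) (hb2 : b2 ≠ 0)
    (f : ℝ × ℝ → Hq) (hf : Integrable f)
    (hLf : Integrable (Ls a1 b1 d1 a2 b2 d2 f)) :
    ∀ᵐ x : ℝ × ℝ, Pcomp ε (f x) =
      Pcomp ε (∫ ω : ℝ × ℝ, Kker qi d1 (-b1) a1 ω.1 x.1 *
        Ls a1 b1 d1 a2 b2 d2 f ω * Kker qj d2 (-b2) a2 ω.2 x.2) := by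
  have hε0 : ε ≠ 0 := by rcases hε with rfl | rfl <;> norm_num
  have hεi : ε⁻¹ = ε := by rcases hε with rfl | rfl <;> norm_num
  have hεa : |ε| = 1 := by rcases hε with rfl | rfl <;> norm_num
  have := inv3 b1 (ε * b2) hb1 (mul_ne_zero hε0 hb2)
    (fun x => a1 * x.1 ^ 2 / (2 * b1) + ε * (a2 * x.2 ^ 2 / (2 * b2)))
    (fun w => -(Real.pi * Real.sign b1 / 4) + d1 * w.1 ^ 2 / (2 * b1) +
      ε * (-(Real.pi * Real.sign b2 / 4) + d2 * w.2 ^ 2 / (2 * b2)))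
    (by fun_prop) (by fun_prop)
    ((Real.sqrt (2 * Real.pi * |b1|))⁻¹ * (Real.sqrt (2 * Real.pi * |b2|))⁻¹)
    (by
      rw [mul_pow, inv_pow, inv_pow, Real.sq_sqrt (by positivity), Real.sq_sqrt (by positivity),
        abs_mul, hεa, one_mul])
    (fun x => Pcomp ε (f x)) (fun w => Pcomp ε (Ls a1 b1 d1 a2 b2 d2 f w))
    ((Pcomp ε).integrable_comp hf) ((Pcomp ε).integrable_comp hLf) (by
      intro w
      rw [Ls, ← (Pcomp ε).integral_comp_comm (integrable_Kker _ _ _ _ _ _ _ _ hf)]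
      congr 1; ext x
      rw [Pcomp_ker ε hε]
      congr 5
      rw [div_mul_eq_div_div (x.2 * w.2) ε b2, div_eq_mul_inv _ ε, hεi]
      ring)
  filter_upwards [this] with x hx
  rw [hx, ← (Pcomp ε).integral_comp_comm (integrable_Kker _ _ _ _ _ _ _ _ hLf)]
  congr 1; ext w
  rw [Pcomp_ker ε hε, abs_neg, abs_neg, Real.sign_neg, Real.sign_neg]
  congr 5
  rw [div_mul_eq_div_div (x.2 * w.2) ε b2, div_eq_mul_inv _ ε, hεi]
  simp only [mul_neg, div_neg]
  ring

theorem stmt14 (a1 b1 c1 d1 a2 b2 c2 d2 : ℝ)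
    (hA1 : a1 * d1 - b1 * c1 = 1) (hA2 : a2 * d2 - b2 * c2 = 1)
    (hb1 : b1 ≠ 0) (hb2 : b2 ≠ 0)
    (f : ℝ × ℝ → Hq) (hf : Integrable f)
    (hLf : Integrable (Ls a1 b1 d1 a2 b2 d2 f)) :
    ∀ᵐ x : ℝ × ℝ, f x =
      ∫ ω : ℝ × ℝ, Kker qi d1 (-b1) a1 ω.1 x.1 *
        Ls a1 b1 d1 a2 b2 d2 f ω * Kker qj d2 (-b2) a2 ω.2 x.2 := by
  filter_upwards [Pcomp_main 1 (Or.inl rfl) a1 b1 d1 a2 b2 d2 hb1 hb2 f hf hLf,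
    Pcomp_main (-1) (Or.inr rfl) a1 b1 d1 a2 b2 d2 hb1 hb2 f hf hLf] with x h1 h2
  exact Pcomp_inj _ _ h1 h2
end
end
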